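/- arXiv:1302.1624 — 7 statements merged into one kernel-verified Lean document; each statement's English description precedes it below -/
import Mathlib

section
/- For any m₀, m₁ ∈ ℝ and σ > 0, the minimal discrimination error between the equal-width Gaussian densities p_{m₀,σ} and p_{m₁,σ} satisfies P_e(p_{m₀,σ}, p_{m₁,σ}) = ½(1 − erf(|m₁ − m₀|/(2σ))). -/
open MeasureTheory

/-- The Gaussian density `p_{m,σ}(x) = (πσ²)^{-1/2} exp(−(x−m)²/σ²)`. -/
noncomputable def gauss (m σ x : ℝ) : ℝ :=
  (Real.sqrt (Real.pi * σ ^ 2))⁻¹ * Real.exp (-(x - m) ^ 2 / σ ^ 2)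

/-- Minimal discrimination error `P_e(p₀,p₁) = ½(1 − ½ ∫ |p₀ − p₁|)`. -/
noncomputable def minErr (p₀ p₁ : ℝ → ℝ) : ℝ :=
  (1/2) * (1 - (1/2) * ∫ x, |p₀ x - p₁ x|)

/-- The error function `erf t = (2/√π) ∫₀ᵗ e^{−s²} ds`. -/
noncomputable def erf (t : ℝ) : ℝ :=
  (2 / Real.sqrt Real.pi) * ∫ s in (0:ℝ)..t, Real.exp (-s ^ 2)

theorem setIntegral_Ioi_comp_add_right (f : ℝ → ℝ) (a c : ℝ) :
    ∫ x in Set.Ioi a, f (x + c) = ∫ x in Set.Ioi (a + c), f x := by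
  have h := (measurePreserving_add_right volume c).setIntegral_preimage_emb
    (measurableEmbedding_addRight c) f (Set.Ioi (a + c))
  simpa using h

theorem integrable_exp_neg_sq : Integrable fun x : ℝ => Real.exp (-x ^ 2) := by
  simpa using integrable_exp_neg_mul_sq one_pos

theorem abs_exp_neg_sq_sub (u a : ℝ) :
    |Real.exp (-(u + a) ^ 2) - Real.exp (-(u - a) ^ 2)| =
      Real.exp (-(|u| + -|a|) ^ 2) - Real.exp (-(|u| + |a|) ^ 2) := by
  have key : Real.exp (-(|u| + |a|) ^ 2) ≤ Real.exp (-(|u| + -|a|) ^ 2) := by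
    apply Real.exp_le_exp.2
    nlinarith [mul_nonneg (abs_nonneg u) (abs_nonneg a)]
  have h₁ : (|u| + |a|) ^ 2 = u ^ 2 + 2 * |u * a| + a ^ 2 := by
    rw [add_sq, sq_abs, sq_abs, abs_mul]; ring
  have h₂ : (|u| + -|a|) ^ 2 = u ^ 2 - 2 * |u * a| + a ^ 2 := by
    rw [add_sq, neg_sq, sq_abs, sq_abs, abs_mul]; ring
  rw [h₁, h₂] at key ⊢
  rcases le_total 0 (u * a) with h | h
  · rw [abs_of_nonneg h] at key ⊢
    rw [show (u + a) ^ 2 = u ^ 2 + 2 * (u * a) + a ^ 2 by ring,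
      show (u - a) ^ 2 = u ^ 2 - 2 * (u * a) + a ^ 2 by ring,
      abs_of_nonpos (sub_nonpos.2 key), neg_sub]
  · rw [abs_of_nonpos h] at key ⊢
    rw [show (u + a) ^ 2 = u ^ 2 - 2 * -(u * a) + a ^ 2 by ring,
      show (u - a) ^ 2 = u ^ 2 + 2 * -(u * a) + a ^ 2 by ring,
      abs_of_nonneg (sub_nonneg.2 key)]

theorem integral_symm_exp_neg_sq (b : ℝ) :
    ∫ x in (-b)..b, Real.exp (-x ^ 2) = 2 * ∫ x in (0 : ℝ)..b, Real.exp (-x ^ 2) := by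
  have h := intervalIntegral.integral_comp_neg (a := 0) (b := b)
    fun x : ℝ => Real.exp (-x ^ 2)
  simp only [neg_sq, neg_zero] at h
  rw [← intervalIntegral.integral_add_adjacent_intervals (b := 0)
    integrable_exp_neg_sq.intervalIntegrable integrable_exp_neg_sq.intervalIntegrable, ← h]
  ring

theorem integral_abs_exp_neg_sq_sub (a : ℝ) :
    ∫ u : ℝ, |Real.exp (-(u + a) ^ 2) - Real.exp (-(u - a) ^ 2)| =
      4 * ∫ x in (0 : ℝ)..|a|, Real.exp (-x ^ 2) := by
  simp_rw [abs_exp_neg_sq_sub]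
  rw [integral_comp_abs
      (f := fun v => Real.exp (-(v + -|a|) ^ 2) - Real.exp (-(v + |a|) ^ 2)),
    integral_sub (integrable_exp_neg_sq.comp_add_right _).integrableOn
      (integrable_exp_neg_sq.comp_add_right _).integrableOn,
    setIntegral_Ioi_comp_add_right (fun x => Real.exp (-x ^ 2)),
    setIntegral_Ioi_comp_add_right (fun x => Real.exp (-x ^ 2)), zero_add, zero_add,
    intervalIntegral.integral_Ioi_sub_Ioi' integrable_exp_neg_sq.integrableOn
      integrable_exp_neg_sq.integrableOn, integral_symm_exp_neg_sq]
  ring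

theorem integral_eq_mul_integral_comp_affine (f : ℝ → ℝ) {σ : ℝ} (hσ : 0 < σ) (c : ℝ) :
    ∫ x, f x = σ * ∫ u, f (σ * u + c) := by
  rw [Measure.integral_comp_mul_left (fun x => f (x + c)), integral_add_right_eq_self f,
    abs_of_pos (inv_pos.2 hσ), smul_eq_mul, mul_inv_cancel_left₀ hσ.ne']

theorem gauss_affine (m c u : ℝ) {σ : ℝ} (hσ : 0 < σ) :
    gauss m σ (σ * u + c) =
      (Real.sqrt Real.pi * σ)⁻¹ * Real.exp (-(u + (c - m) / σ) ^ 2) := by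
  rw [gauss, Real.sqrt_mul Real.pi_pos.le, Real.sqrt_sq hσ.le]
  congr 2
  field_simp
  ring

/-- the minimal discrimination error between two equal-width
Gaussians is `½(1 − erf(|m₁ − m₀|/(2σ)))`. -/
theorem stmt_1 (m₀ m₁ σ : ℝ) (hσ : 0 < σ) :
    minErr (gauss m₀ σ) (gauss m₁ σ) = (1/2) * (1 - erf (|m₁ - m₀| / (2 * σ))) := by
  have h₀ : ((m₀ + m₁) / 2 - m₀) / σ = (m₁ - m₀) / (2 * σ) := by field_simp; ring
  have h₁ : ((m₀ + m₁) / 2 - m₁) / σ = -((m₁ - m₀) / (2 * σ)) := by field_simp; ring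
  have hπ : 0 < Real.sqrt Real.pi := Real.sqrt_pos.2 Real.pi_pos
  rw [minErr, integral_eq_mul_integral_comp_affine _ hσ ((m₀ + m₁) / 2)]
  simp_rw [gauss_affine _ _ _ hσ, h₀, h₁, ← mul_sub, abs_mul, ← sub_eq_add_neg]
  rw [integral_const_mul, integral_abs_exp_neg_sq_sub, abs_of_pos (by positivity), erf,
    abs_div, abs_of_pos (show 0 < 2 * σ by positivity)]
  field_simp
  ring
end

section
/- For i < j in {0,1,2} and τ ∈ (0,1], let B_{ij}(τ) be the 3×3 real matrix acting as the identity on the mode k ∉ {i,j} and acting on modes (i,j) as the block [[√τ, √(1−τ)], [−√(1−τ), √τ]]. Then for all α, β ∈ (0,1), setting η := αβ, γ := (1−α)/(1−αβ), and δ' := γβ, one has the matrix identity B₀₂(β) · B₀₁(α) = B₁₂(γ)ᵀ · B₀₁(η) · B₁₂(δ'). -/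
open Matrix

/-- Scattering matrix of a beamsplitter with transmittivity `τ` acting on modes
`i < j` of a 3-mode system: identity on the remaining mode, and
`[[√τ, √(1−τ)], [−√(1−τ), √τ]]` on modes `(i,j)`. -/
noncomputable def bs3 (i j : Fin 3) (τ : ℝ) : Matrix (Fin 3) (Fin 3) ℝ :=
  fun k l =>
    if k = i ∧ l = i then Real.sqrt τ
    else if k = i ∧ l = j then Real.sqrt (1 - τ)
    else if k = j ∧ l = i then -Real.sqrt (1 - τ)
    else if k = j ∧ l = j then Real.sqrt τ
    else if k = l then 1 else 0

/-- the beamsplitter composition identity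
`B₀₂(β) · B₀₁(α) = B₁₂(γ)ᵀ · B₀₁(η) · B₁₂(δ')`
with `η = αβ`, `γ = (1−α)/(1−αβ)`, `δ' = γβ`. -/
theorem stmt_4 (α β : ℝ) (hα : α ∈ Set.Ioo (0:ℝ) 1) (hβ : β ∈ Set.Ioo (0:ℝ) 1) :
    bs3 0 2 β * bs3 0 1 α
      = (bs3 1 2 ((1 - α) / (1 - α * β)))ᵀ * bs3 0 1 (α * β)
          * bs3 1 2 ((1 - α) / (1 - α * β) * β) := by
  obtain ⟨hα0, hα1⟩ := hα
  obtain ⟨hβ0, hβ1⟩ := hβ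
  have hD : 0 < 1 - α * β := by nlinarith
  have hγ : 1 - (1 - α) / (1 - α * β) = α * (1 - β) / (1 - α * β) := by
    field_simp
    ring
  have hδ : 1 - (1 - α) / (1 - α * β) * β = (1 - β) / (1 - α * β) := by
    field_simp
    ring
  have sγ : √((1 - α) / (1 - α * β)) = √(1 - α) / √(1 - α * β) :=
    Real.sqrt_div (by linarith) _
  have sγ' : √(1 - (1 - α) / (1 - α * β)) = √α * √(1 - β) / √(1 - α * β) := by
    rw [hγ, Real.sqrt_div (mul_nonneg hα0.le (by linarith)), Real.sqrt_mul hα0.le]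
  have sδ : √((1 - α) / (1 - α * β) * β) = √(1 - α) / √(1 - α * β) * √β := by
    rw [Real.sqrt_mul (div_nonneg (by linarith) hD.le), sγ]
  have sδ' : √(1 - (1 - α) / (1 - α * β) * β) = √(1 - β) / √(1 - α * β) := by
    rw [hδ, Real.sqrt_div (by linarith)]
  have sη : √(α * β) = √α * √β := Real.sqrt_mul hα0.le _
  have ha : √α ^ 2 = α := Real.sq_sqrt hα0.le
  have hb : √β ^ 2 = β := Real.sq_sqrt hβ0.le
  have ha' : √(1 - α) ^ 2 = 1 - α := Real.sq_sqrt (by linarith)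
  have hb' : √(1 - β) ^ 2 = 1 - β := Real.sq_sqrt (by linarith)
  have hd : √(1 - α * β) ^ 2 = 1 - α * β := Real.sq_sqrt hD.le
  have hd0 : √(1 - α * β) ≠ 0 := (Real.sqrt_pos.2 hD).ne'
  ext i j
  fin_cases i <;> fin_cases j <;>
    simp [bs3, Matrix.mul_apply, Fin.sum_univ_three, sγ, sγ', sδ, sδ', sη] <;>
    field_simp <;> grind
end

section
/- Let a ≥ 0 and φ, r, θ, ψ ∈ ℝ. Define W : ℝ² → ℝ by W(x,p) := (1/π) exp(−e^{2r} u(x,p)² − e^{−2r} v(x,p)²), where u(x,p) := cos(θ/2)(x − a cos φ) + sin(θ/2)(p − a sin φ) and v(x,p) := −sin(θ/2)(x − a cos φ) + cos(θ/2)(p − a sin φ). Then for every x ∈ ℝ, ∫_ℝ W(x cos ψ − p sin ψ, x sin ψ + p cos ψ) dp = (πσ²)^{−1/2} exp(−(x − x₀)²/σ²), where x₀ := a cos(ψ − φ) and σ² := e^{−2r} cos²(ψ − θ/2) + e^{2r} sin²(ψ − θ/2). -/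
open MeasureTheory Real

/-- The marginal of a centered Gaussian with unit determinant, in coordinates rotated by the angle
with cosine `c` and sine `s`. -/
lemma integral_exp_neg_rotated_sq {A B c s : ℝ} (hA : 0 < A) (hB : 0 < B) (hAB : A * B = 1)
    (hcs : c ^ 2 + s ^ 2 = 1) (X : ℝ) :
    ∫ p : ℝ, exp (-A * (X * c - p * s) ^ 2 - B * (X * s + p * c) ^ 2) =
      √(π / (B * c ^ 2 + A * s ^ 2)) * exp (-X ^ 2 / (B * c ^ 2 + A * s ^ 2)) := by
  have hpos : 0 < B * c ^ 2 + A * s ^ 2 := by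
    rcases eq_or_ne c 0 with rfl | hc
    · have : s ^ 2 = 1 := by linarith
      rw [this]
      positivity
    · positivity
  set D := B * c ^ 2 + A * s ^ 2 with hD
  have key : ∀ p : ℝ, exp (-A * (X * c - p * s) ^ 2 - B * (X * s + p * c) ^ 2) =
      exp (-D * (p - X * s * c * (A - B) / D) ^ 2) * exp (-X ^ 2 / D) := by
    intro p
    rw [← exp_add]
    congr 1
    have hdet : (A * c ^ 2 + B * s ^ 2) * D - (s * c * (A - B)) ^ 2 = 1 := by
      calc _ = A * B * (c ^ 2 + s ^ 2) ^ 2 := by rw [hD]; ring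
        _ = 1 := by rw [hAB, hcs]; norm_num
    have hsq : -A * (X * c - p * s) ^ 2 - B * (X * s + p * c) ^ 2 =
        -D * p ^ 2 + 2 * p * (X * s * c * (A - B)) - (A * c ^ 2 + B * s ^ 2) * X ^ 2 := by
      rw [hD]; ring
    rw [hsq]
    clear_value D
    field_simp
    linear_combination -X ^ 2 * hdet
  simp_rw [key]
  rw [integral_mul_const, integral_sub_right_eq_self (fun p : ℝ => exp (-D * p ^ 2)),
    integral_gaussian]

/-- the marginal of the Wigner function of a squeezed coherent state
along the quadrature at angle `ψ` is a Gaussian with mean `x₀ = a cos(ψ−φ)` and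
variance parameter `σ² = e^{−2r} cos²(ψ−θ/2) + e^{2r} sin²(ψ−θ/2)`. -/
theorem stmt_6 (a φ r θ ψ : ℝ) (ha : 0 ≤ a)
    (W : ℝ → ℝ → ℝ)
    (hW : ∀ x p, W x p = (1 / Real.pi) *
      Real.exp (-(Real.exp (2 * r)) *
          (Real.cos (θ / 2) * (x - a * Real.cos φ)
            + Real.sin (θ / 2) * (p - a * Real.sin φ)) ^ 2
        - Real.exp (-(2 * r)) *
          (-(Real.sin (θ / 2)) * (x - a * Real.cos φ)
            + Real.cos (θ / 2) * (p - a * Real.sin φ)) ^ 2)) :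
    ∀ x : ℝ,
      (∫ p : ℝ, W (x * Real.cos ψ - p * Real.sin ψ) (x * Real.sin ψ + p * Real.cos ψ))
        = (Real.sqrt (Real.pi *
            (Real.exp (-(2 * r)) * Real.cos (ψ - θ / 2) ^ 2
              + Real.exp (2 * r) * Real.sin (ψ - θ / 2) ^ 2)))⁻¹ *
          Real.exp (-(x - a * Real.cos (ψ - φ)) ^ 2 /
            (Real.exp (-(2 * r)) * Real.cos (ψ - θ / 2) ^ 2
              + Real.exp (2 * r) * Real.sin (ψ - θ / 2) ^ 2)) := by
  intro x
  set δ := ψ - θ / 2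
  have hcos : cos δ = cos ψ * cos (θ / 2) + sin ψ * sin (θ / 2) := cos_sub _ _
  have hsin : sin δ = sin ψ * cos (θ / 2) - cos ψ * sin (θ / 2) := sin_sub _ _
  set X := x - a * cos (ψ - φ) with hX
  have hψ : sin ψ ^ 2 + cos ψ ^ 2 = 1 := sin_sq_add_cos_sq ψ
  have hint : ∀ p : ℝ, W (x * cos ψ - p * sin ψ) (x * sin ψ + p * cos ψ) =
      1 / π * exp (-exp (2 * r) * (X * cos δ - (p - -(a * sin (ψ - φ))) * sin δ) ^ 2
        - exp (-(2 * r)) * (X * sin δ + (p - -(a * sin (ψ - φ))) * cos δ) ^ 2) := by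
    intro p
    have hu : cos (θ / 2) * (x * cos ψ - p * sin ψ - a * cos φ)
        + sin (θ / 2) * (x * sin ψ + p * cos ψ - a * sin φ) =
        X * cos δ - (p - -(a * sin (ψ - φ))) * sin δ := by
      rw [hX, hcos, hsin, cos_sub, sin_sub]
      linear_combination (a * cos (θ / 2) * cos φ + a * sin (θ / 2) * sin φ) * hψ
    have hv : -sin (θ / 2) * (x * cos ψ - p * sin ψ - a * cos φ)
        + cos (θ / 2) * (x * sin ψ + p * cos ψ - a * sin φ) =
        X * sin δ + (p - -(a * sin (ψ - φ))) * cos δ := by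
      rw [hX, hcos, hsin, cos_sub, sin_sub]
      linear_combination (a * cos (θ / 2) * sin φ - a * sin (θ / 2) * cos φ) * hψ
    rw [hW, hu, hv]
  simp_rw [hint]
  rw [integral_const_mul, integral_sub_right_eq_self (fun p : ℝ =>
      exp (-exp (2 * r) * (X * cos δ - p * sin δ) ^ 2
        - exp (-(2 * r)) * (X * sin δ + p * cos δ) ^ 2)),
    integral_exp_neg_rotated_sq (exp_pos _) (exp_pos _) (by rw [← exp_add]; simp)
      (cos_sq_add_sin_sq δ), ← mul_assoc]
  congr 1
  rw [sqrt_div pi_pos.le, sqrt_mul pi_pos.le, mul_inv, ← mul_div_assoc, one_div_mul_eq_div,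
    sqrt_div_self, div_eq_mul_inv]
end

section
/- Let E > 0, ν ≥ 0, and c ∈ [−1, 0], with (c, ν) ≠ (−1, 0). Define σ²(r) := e^{−2r}(1−c)/2 + e^{2r}(1+c)/2 + ν, g(r) := (E − sinh²r)/σ²(r) for r ∈ [0, arcsinh √E], and r* := ½ ln[(√((2E+1+ν)² − 4E(E+1)c²) + c)/((c+1)(2E+1) + ν)]. Then r* ∈ [0, arcsinh √E], and g attains its maximum over [0, arcsinh √E] at r = r* and at no other point. -/
/-- `sinh²` expressed through `exp (2 * r)`. -/
lemma sinh_sq_eq_exp_two_mul (r : ℝ) :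
    Real.sinh r ^ 2 =
      (Real.exp (2 * r) ^ 2 - 2 * Real.exp (2 * r) + 1) / (4 * Real.exp (2 * r)) := by
  have h : Real.exp (2 * r) = Real.exp r ^ 2 := by rw [← Real.exp_nat_mul]; norm_num
  have h0 := (Real.exp_pos r).ne'
  rw [h, Real.sinh_eq, Real.exp_neg]
  field_simp
  ring

/-- The difference `N(x) D(y) - N(y) D(x)` of the numerator `N(x) = 2Ax - x² - 1` and denominator
`D(x) = (1+c)x² + 2νx + (1-c)` is a perfect square up to a factor when `y` is critical for
`N / D`. -/
lemma cross_difference_eq_neg_sq {A ν c y : ℝ} (x : ℝ)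
    (hy : ((c + 1) * A + ν) * y ^ 2 - 2 * c * y - (A * (1 - c) + ν) = 0) :
    (2 * A * x - x ^ 2 - 1) * ((1 + c) * y ^ 2 + 2 * ν * y + (1 - c))
      - (2 * A * y - y ^ 2 - 1) * ((1 + c) * x ^ 2 + 2 * ν * x + (1 - c))
      = -(2 * (((c + 1) * A + ν) * y - c)) * (x - y) ^ 2 := by
  linear_combination (2 * (y - x)) * hy

/-- the figure of merit `g(r) = (E − sinh²r)/σ²(r)` with
`σ²(r) = e^{−2r}(1−c)/2 + e^{2r}(1+c)/2 + ν` attains its maximum over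
`[0, arcsinh √E]` exactly at the point `r*` given by the closed formula. -/
theorem stmt_8 (E ν c : ℝ) (hE : 0 < E) (hν : 0 ≤ ν)
    (hc : c ∈ Set.Icc (-1 : ℝ) 0) (hcv : ¬(c = -1 ∧ ν = 0))
    (σ2 g : ℝ → ℝ)
    (hσ2 : ∀ r, σ2 r = Real.exp (-(2 * r)) * (1 - c) / 2
      + Real.exp (2 * r) * (1 + c) / 2 + ν)
    (hg : ∀ r, g r = (E - Real.sinh r ^ 2) / σ2 r)
    (rstar : ℝ)
    (hr : rstar = (1/2) * Real.log
      ((Real.sqrt ((2 * E + 1 + ν) ^ 2 - 4 * E * (E + 1) * c ^ 2) + c)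
        / ((c + 1) * (2 * E + 1) + ν))) :
    rstar ∈ Set.Icc 0 (Real.arsinh (Real.sqrt E)) ∧
    (∀ r ∈ Set.Icc 0 (Real.arsinh (Real.sqrt E)), g r ≤ g rstar) ∧
    (∀ r ∈ Set.Icc 0 (Real.arsinh (Real.sqrt E)), g r = g rstar → r = rstar) := by
  obtain ⟨hc1, hc0⟩ := hc
  set A : ℝ := 2 * E + 1 with hA
  set K : ℝ := (c + 1) * A + ν with hK
  set S : ℝ := Real.sqrt ((A + ν) ^ 2 - 4 * E * (E + 1) * c ^ 2) with hS
  have hApos : 0 < A := by positivity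
  have hKpos : 0 < K := by
    rcases hc1.eq_or_lt with h | h
    · have hν' : ν ≠ 0 := fun h0 => hcv ⟨h.symm, h0⟩
      have : 0 < ν := lt_of_le_of_ne hν hν'.symm
      rw [hK, ← h]
      linarith
    · have : 0 < (c + 1) * A := mul_pos (by linarith) hApos
      linarith
  have hcc : c ^ 2 ≤ 1 := by nlinarith
  have hrad : 0 < (A + ν) ^ 2 - 4 * E * (E + 1) * c ^ 2 := by
    have h1 : 4 * E * (E + 1) * c ^ 2 ≤ 4 * E * (E + 1) * 1 :=
      mul_le_mul_of_nonneg_left hcc (by positivity)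
    have h2 : 0 ≤ A * ν := by positivity
    nlinarith [sq_nonneg ν]
  have hSpos : 0 < S := Real.sqrt_pos.2 hrad
  have hSsq : S ^ 2 = (A + ν) ^ 2 - 4 * E * (E + 1) * c ^ 2 := Real.sq_sqrt hrad.le
  have hKS : K ≤ S + c := by
    have : K - c ≤ S := by
      refine Real.le_sqrt_of_sq_le ?_
      have h1 : 0 ≤ -c * E * K := mul_nonneg (mul_nonneg (by linarith) hE.le) hKpos.le
      have h2 : (A + ν) ^ 2 - 4 * E * (E + 1) * c ^ 2 - (K - c) ^ 2 = 4 * (-c * E * K) := by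
        rw [hK, hA]; ring
      linarith
    linarith
  set y : ℝ := (S + c) / K with hy
  have hKy : K * y = S + c := by rw [hy]; field_simp
  have hy1 : 1 ≤ y := (one_le_div hKpos).2 hKS
  have hypos : 0 < y := by linarith
  have hcrit : K * y ^ 2 - 2 * c * y - (A * (1 - c) + ν) = 0 := by
    have : K * (K * y ^ 2 - 2 * c * y - (A * (1 - c) + ν)) = 0 := by
      have h1 : K * (K * y ^ 2 - 2 * c * y - (A * (1 - c) + ν))
          = (K * y - c) ^ 2 - c ^ 2 - K * (A * (1 - c) + ν) := by ring
      rw [h1, hKy, add_sub_cancel_right, hSsq, hK, hA]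
      ring
    exact (mul_eq_zero.1 this).resolve_left hKpos.ne'
  have hexp : Real.exp (2 * rstar) = y := by
    rw [hr, ← mul_assoc, show (2 : ℝ) * (1 / 2) = 1 by norm_num, one_mul, Real.exp_log hypos]
  have hD : ∀ x : ℝ, 0 < x → 0 < (1 + c) * x ^ 2 + 2 * ν * x + (1 - c) := fun x hx => by
    have h1 : 0 ≤ (1 + c) * x ^ 2 := mul_nonneg (by linarith) (sq_nonneg x)
    have h2 : 0 ≤ 2 * ν * x := by positivity
    linarith
  have hcross : ∀ x : ℝ,
      (2 * A * x - x ^ 2 - 1) * ((1 + c) * y ^ 2 + 2 * ν * y + (1 - c))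
      - (2 * A * y - y ^ 2 - 1) * ((1 + c) * x ^ 2 + 2 * ν * x + (1 - c))
      = -(2 * S) * (x - y) ^ 2 := fun x => by
    rw [cross_difference_eq_neg_sq x hcrit, ← hK, hKy, add_sub_cancel_right]
  have hgx : ∀ r, g r = (2 * A * Real.exp (2 * r) - Real.exp (2 * r) ^ 2 - 1)
      / (2 * ((1 + c) * Real.exp (2 * r) ^ 2 + 2 * ν * Real.exp (2 * r) + (1 - c))) := fun r => by
    have h0 := Real.exp_pos (2 * r)
    have hd := hD _ h0
    have hσ : σ2 r = ((1 + c) * Real.exp (2 * r) ^ 2 + 2 * ν * Real.exp (2 * r) + (1 - c))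
        / (2 * Real.exp (2 * r)) := by
      rw [hσ2, Real.exp_neg]
      field_simp
      ring
    have hN : E - Real.sinh r ^ 2
        = (2 * A * Real.exp (2 * r) - Real.exp (2 * r) ^ 2 - 1) / (4 * Real.exp (2 * r)) := by
      rw [sinh_sq_eq_exp_two_mul, hA]
      field_simp
      ring
    rw [hg, hσ, hN, div_div_div_eq, div_eq_div_iff (by positivity) (by positivity)]
    ring
  have hdiff : ∀ r, g rstar - g r = S * (Real.exp (2 * r) - y) ^ 2
      / (((1 + c) * Real.exp (2 * r) ^ 2 + 2 * ν * Real.exp (2 * r) + (1 - c))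
        * ((1 + c) * y ^ 2 + 2 * ν * y + (1 - c))) := fun r => by
    have hd := hD _ (Real.exp_pos (2 * r))
    have hdy := hD y hypos
    rw [hgx, hgx, hexp, div_sub_div _ _ (by positivity) (by positivity),
      div_eq_div_iff (by positivity) (by positivity)]
    linear_combination
      (-2 * ((1 + c) * Real.exp (2 * r) ^ 2 + 2 * ν * Real.exp (2 * r) + (1 - c))
        * ((1 + c) * y ^ 2 + 2 * ν * y + (1 - c))) * hcross (Real.exp (2 * r))
  have hmax : ∀ r, g r ≤ g rstar := fun r => by
    have hd := hD _ (Real.exp_pos (2 * r))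
    have hdy := hD y hypos
    have : 0 ≤ g rstar - g r := by rw [hdiff]; positivity
    linarith
  refine ⟨⟨?_, ?_⟩, fun r _ => hmax r, fun r _ h => ?_⟩
  · rw [hr]
    have := Real.log_nonneg hy1
    positivity
  · have hσpos : 0 < σ2 rstar := by
      have h1 : 0 < Real.exp (-(2 * rstar)) * (1 - c) :=
        mul_pos (Real.exp_pos _) (by linarith)
      have h2 : 0 ≤ Real.exp (2 * rstar) * (1 + c) :=
        mul_nonneg (Real.exp_pos _).le (by linarith)
      rw [hσ2]
      linarith
    have hg0 : 0 < g 0 := by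
      have hσ0 : 0 < σ2 0 := by
        rw [hσ2, mul_zero, neg_zero, Real.exp_zero]
        linarith
      rw [hg, Real.sinh_zero]
      exact div_pos (by linarith) hσ0
    have hpos : 0 < g rstar := hg0.trans_le (hmax 0)
    rw [hg, div_pos_iff_of_pos_right hσpos] at hpos
    rw [← Real.sinh_le_sinh, Real.sinh_arsinh]
    exact Real.le_sqrt_of_sq_le (by linarith)
  · have hd := hD _ (Real.exp_pos (2 * r))
    have hdy := hD y hypos
    have h0 := hdiff r
    rw [h, sub_self, eq_comm, div_eq_zero_iff,
      or_iff_left (mul_pos hd hdy).ne', mul_eq_zero, or_iff_right hSpos.ne',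
      sq_eq_zero_iff, sub_eq_zero, ← hexp] at h0
    linarith [Real.exp_injective h0]
end

section
/- Let E > 0, ν ≥ 0, and c ∈ [−1, 0], with (c, ν) ≠ (−1, 0), and let r* := ½ ln[(√((2E+1+ν)² − 4E(E+1)c²) + c)/((c+1)(2E+1) + ν)]. Then r* ≥ 0, and r* > 0 if and only if c < 0 (equivalently, r* = 0 if and only if c = 0). -/
/-- the optimal squeezing magnitude `r*` is nonnegative, and it is
strictly positive if and only if `c < 0` (equivalently, `r* = 0` iff `c = 0`). -/
theorem stmt_9 (E ν c : ℝ) (hE : 0 < E) (hν : 0 ≤ ν)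
    (hc : c ∈ Set.Icc (-1 : ℝ) 0) (hcv : ¬(c = -1 ∧ ν = 0))
    (rstar : ℝ)
    (hr : rstar = (1/2) * Real.log
      ((Real.sqrt ((2 * E + 1 + ν) ^ 2 - 4 * E * (E + 1) * c ^ 2) + c)
        / ((c + 1) * (2 * E + 1) + ν))) :
    0 ≤ rstar ∧ (0 < rstar ↔ c < 0) ∧ (rstar = 0 ↔ c = 0) := by
  obtain ⟨hc₁, hc₀⟩ := hc
  have hD : 0 < (c + 1) * (2 * E + 1) + ν := by
    rcases hc₁.eq_or_lt with h | h
    · have : ν ≠ 0 := fun h0 => hcv ⟨h.symm, h0⟩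
      have : 0 < ν := lt_of_le_of_ne hν this.symm
      rw [← h]
      linarith
    · have : 0 < (c + 1) * (2 * E + 1) := mul_pos (by linarith) (by linarith)
      linarith
  rcases hc₀.eq_or_lt with h | h
  · have hzero : rstar = 0 := by
      subst h
      have hsqrt : Real.sqrt ((2 * E + 1 + ν) ^ 2 - 4 * E * (E + 1) * 0 ^ 2)
          = 2 * E + 1 + ν := by
        rw [show (2 * E + 1 + ν) ^ 2 - 4 * E * (E + 1) * 0 ^ 2 = (2 * E + 1 + ν) ^ 2 by ring]
        exact Real.sqrt_sq (by linarith)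
      rw [hr, hsqrt, show (2 * E + 1 + ν + 0) = (0 + 1) * (2 * E + 1) + ν by ring,
        div_self hD.ne', Real.log_one, mul_zero]
    simp [hzero, h]
  · have hsqrt : (c + 1) * (2 * E + 1) + ν - c
        < Real.sqrt ((2 * E + 1 + ν) ^ 2 - 4 * E * (E + 1) * c ^ 2) := by
      apply Real.lt_sqrt_of_sq_lt
      have := mul_pos (mul_pos (neg_pos.mpr h) hE) hD
      linarith
    have hlog := Real.log_pos ((one_lt_div hD).mpr (sub_lt_iff_lt_add.mp hsqrt))
    have hpos : 0 < rstar := by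
      rw [hr]
      linarith
    exact ⟨hpos.le, iff_of_true hpos h, iff_of_false hpos.ne' h.ne⟩
end

section
/- Let E > 0, ν ≥ 0, δ ∈ (0, π], and c := −|cos δ|, with (c, ν) ≠ (−1, 0). For r ∈ [0, arcsinh √E] set a(r) := √(E − sinh²r) and σ(r) := √(e^{−2r}(1−c)/2 + e^{2r}(1+c)/2 + ν), and let P(r) := P_e(p_{−a(r)sin(δ/2), σ(r)}, p_{+a(r)sin(δ/2), σ(r)}). Then the minimum of P(r) over r ∈ [0, arcsinh √E] is attained at r = r* := ½ ln[(√((2E+1+ν)² − 4E(E+1)c²) + c)/((c+1)(2E+1) + ν)], and equals ½(1 − erf(a(r*) sin(δ/2)/σ(r*))). -/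
open MeasureTheory

lemma integrable_gauss (m : ℝ) {σ : ℝ} (hσ : 0 < σ) : Integrable (gauss m σ) := by
  have h := ((integrable_exp_neg_mul_sq (b := 1 / σ ^ 2)
    (by positivity)).comp_sub_right m).const_mul
    (Real.sqrt (Real.pi * σ ^ 2))⁻¹
  refine h.congr (Filter.Eventually.of_forall fun x => ?_)
  simp only [gauss]
  congr 2
  ring

lemma gauss_neg_mean_neg (m σ x : ℝ) : gauss (-m) σ (-x) = gauss m σ x := by
  simp only [gauss]
  congr 3
  ring

lemma gauss_eq_gauss_zero_sub (m σ x : ℝ) : gauss m σ x = gauss 0 σ (x - m) := by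
  simp [gauss]

lemma setIntegral_Ioi_gauss (m σ : ℝ) :
    ∫ x in Set.Ioi 0, gauss m σ x = ∫ x in Set.Ioi (-m), gauss 0 σ x := by
  have h := (measurePreserving_sub_right volume m).setIntegral_preimage_emb
    (measurableEmbedding_subRight m) (gauss 0 σ) (Set.Ioi (-m))
  simp only [Set.preimage_sub_const_Ioi, neg_add_cancel] at h
  rw [← h]
  simp_rw [← gauss_eq_gauss_zero_sub]

lemma gauss_neg_mean_le {m x : ℝ} (σ : ℝ) (hm : 0 ≤ m) (hx : 0 ≤ x) :
    gauss (-m) σ x ≤ gauss m σ x := by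
  have hsq : -(x - -m) ^ 2 ≤ -(x - m) ^ 2 := by nlinarith [mul_nonneg hm hx]
  unfold gauss
  gcongr _ * Real.exp (?_ / _)

lemma intervalIntegral_gauss_zero (m : ℝ) {σ : ℝ} (hσ : 0 < σ) :
    ∫ x in (-m)..m, gauss 0 σ x = erf (m / σ) := by
  have hint : ∀ u v : ℝ, IntervalIntegrable (fun s : ℝ => Real.exp (-s ^ 2)) volume u v :=
    fun u v => (by fun_prop : Continuous fun s : ℝ => Real.exp (-s ^ 2)).intervalIntegrable u v
  have hscale : ∀ x : ℝ, gauss 0 σ x =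
      (Real.sqrt Real.pi * σ)⁻¹ * (fun s : ℝ => Real.exp (-s ^ 2)) (x / σ) := by
    intro x
    simp only [gauss, sub_zero]
    rw [Real.sqrt_mul Real.pi_pos.le, Real.sqrt_sq hσ.le, div_pow, neg_div]
  have hsymm : ∫ s in (-(m / σ))..0, Real.exp (-s ^ 2)
      = ∫ s in (0:ℝ)..(m / σ), Real.exp (-s ^ 2) := by
    have h := intervalIntegral.integral_comp_neg (a := 0) (b := m / σ)
      fun s : ℝ => Real.exp (-s ^ 2)
    simpa using h.symm
  have hpi : 0 < Real.sqrt Real.pi := Real.sqrt_pos.2 Real.pi_pos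
  simp_rw [hscale]
  rw [intervalIntegral.integral_const_mul, intervalIntegral.integral_comp_div (fun s : ℝ => Real.exp (-s ^ 2)) hσ.ne',
    neg_div, ← intervalIntegral.integral_add_adjacent_intervals (hint _ 0) (hint 0 _), hsymm, erf,
    smul_eq_mul]
  field_simp
  ring

lemma minErr_gauss {m σ : ℝ} (hm : 0 ≤ m) (hσ : 0 < σ) :
    minErr (gauss (-m) σ) (gauss m σ) = (1/2) * (1 - erf (m / σ)) := by
  have heven : ∀ x : ℝ, |gauss (-m) σ x - gauss m σ x|
      = (fun y : ℝ => |gauss (-m) σ y - gauss m σ y|) |x| := by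
    intro x
    rcases abs_cases x with ⟨h, -⟩ | ⟨h, -⟩
    · simp only [h]
    · have h' := gauss_neg_mean_neg (-m) σ x
      rw [neg_neg] at h'
      simp only [h, gauss_neg_mean_neg, h']
      exact abs_sub_comm _ _
  have hhalf : ∫ x in Set.Ioi (0:ℝ), |gauss (-m) σ x - gauss m σ x| = erf (m / σ) := by
    have hpos : ∫ x in Set.Ioi (0:ℝ), |gauss (-m) σ x - gauss m σ x|
        = ∫ x in Set.Ioi (0:ℝ), (gauss m σ x - gauss (-m) σ x) := by
      refine setIntegral_congr_fun measurableSet_Ioi fun x hx => ?_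
      rw [abs_sub_comm, abs_of_nonneg (sub_nonneg.2 (gauss_neg_mean_le σ hm (le_of_lt hx)))]
    have hint := integrable_gauss 0 hσ
    rw [hpos, integral_sub (integrable_gauss m hσ).integrableOn
      (integrable_gauss (-m) hσ).integrableOn, setIntegral_Ioi_gauss, setIntegral_Ioi_gauss,
      neg_neg, ← intervalIntegral_gauss_zero m hσ,
      ← intervalIntegral.integral_interval_add_Ioi (a := -m) (b := m)
        hint.integrableOn hint.integrableOn,
      add_sub_cancel_right]
  rw [minErr]
  rw [integral_congr_ae (Filter.Eventually.of_forall heven),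
    integral_comp_abs (f := fun y : ℝ => |gauss (-m) σ y - gauss m σ y|), hhalf]
  ring

lemma erf_monotone : Monotone erf := by
  intro u v huv
  have hint : ∀ u v : ℝ, IntervalIntegrable (fun s : ℝ => Real.exp (-s ^ 2)) volume u v :=
    fun u v => (by fun_prop : Continuous fun s : ℝ => Real.exp (-s ^ 2)).intervalIntegrable u v
  have hadd := intervalIntegral.integral_add_adjacent_intervals (hint 0 u) (hint u v)
  have hnn : 0 ≤ ∫ s in u..v, Real.exp (-s ^ 2) :=
    intervalIntegral.integral_nonneg huv fun s _ => (Real.exp_pos _).le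
  unfold erf
  gcongr
  linarith

/-- The squared signal-to-noise ratio `a² / σ²`, as a rational function of `x = exp (2r)`, where
`k = 2E + 1`. -/
noncomputable def snr (k ν c x : ℝ) : ℝ :=
  (1/2) * ((2 * k * x - x ^ 2 - 1) / ((1 - c) + (1 + c) * x ^ 2 + 2 * ν * x))

lemma snr_le_of_isRoot {k ν c x y S : ℝ} (hν : 0 ≤ ν) (hc₀ : -1 ≤ c) (hc₁ : c < 1)
    (hx : 0 < x) (hy : 0 < y) (hS : 0 ≤ S)
    (hyS : (k * (1 + c) + ν) * y = c + S)
    (hroot : k * (1 - c) + ν + 2 * c * y - (k * (1 + c) + ν) * y ^ 2 = 0) :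
    snr k ν c x ≤ snr k ν c y := by
  have hden : ∀ z : ℝ, 0 < z → 0 < (1 - c) + (1 + c) * z ^ 2 + 2 * ν * z := by
    intro z hz
    have h₁ : 0 < 1 - c := by linarith
    have h₂ : 0 ≤ 1 + c := by linarith
    positivity
  unfold snr
  refine mul_le_mul_of_nonneg_left ?_ (by norm_num)
  rw [div_le_div_iff₀ (hden x hx) (hden y hy)]
  have key : (2 * k * y - y ^ 2 - 1) * ((1 - c) + (1 + c) * x ^ 2 + 2 * ν * x)
      - (2 * k * x - x ^ 2 - 1) * ((1 - c) + (1 + c) * y ^ 2 + 2 * ν * y)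
      = 2 * (y - x) ^ 2 * S := by
    linear_combination 2 * (y - x) * hroot + 2 * (y - x) ^ 2 * hyS
  nlinarith [mul_nonneg (sq_nonneg (y - x)) hS]

lemma sinh_sq_eq_exp (r : ℝ) :
    Real.sinh r ^ 2 = (Real.exp (2 * r) + (Real.exp (2 * r))⁻¹ - 2) / 4 := by
  have h : Real.exp (2 * r) = Real.exp r ^ 2 := by rw [← Real.exp_nat_mul]; norm_num
  rw [Real.sinh_eq, Real.exp_neg, h]
  field_simp
  ring

lemma div_eq_snr (E ν c r : ℝ) :
    (E - Real.sinh r ^ 2) / (Real.exp (-(2 * r)) * (1 - c) / 2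
      + Real.exp (2 * r) * (1 + c) / 2 + ν) = snr (2 * E + 1) ν c (Real.exp (2 * r)) := by
  rw [sinh_sq_eq_exp, Real.exp_neg]
  have hx : 0 < Real.exp (2 * r) := Real.exp_pos _
  generalize Real.exp (2 * r) = x at hx
  rw [snr, ← mul_div_assoc, ← mul_div_mul_left (E - (x + x⁻¹ - 2) / 4) _ (mul_pos two_pos hx).ne']
  congr 1
  · field_simp
    ring
  · field_simp

lemma isRoot_one_le {k ν c y S : ℝ} (hc : c ≤ 0) (hk : 1 ≤ k) (hB : 0 < k * (1 + c) + ν)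
    (hS : 0 ≤ S) (hyS : (k * (1 + c) + ν) * y = c + S)
    (hroot : k * (1 - c) + ν + 2 * c * y - (k * (1 + c) + ν) * y ^ 2 = 0) : 1 ≤ y := by
  by_contra! h
  have hprod : (1 - y) * ((k * (1 + c) + ν) * (1 - y) + 2 * S) = 2 * c * (k - 1) := by
    linear_combination hroot - 2 * (1 - y) * hyS
  have hneg : 2 * c * (k - 1) ≤ 0 := by nlinarith
  have hpos : 0 < (1 - y) * ((k * (1 + c) + ν) * (1 - y) + 2 * S) := by
    have : 0 < 1 - y := by linarith
    positivity
  linarith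

/-- optimal Gaussian quantum reading: the error probability
`P(r) = P_e(p_{−a(r)sin(δ/2),σ(r)}, p_{+a(r)sin(δ/2),σ(r)})` over
`r ∈ [0, arcsinh √E]` is minimized at `r = r*` given by the closed formula, and
the minimum equals `½(1 − erf(a(r*) sin(δ/2)/σ(r*)))`. -/
theorem stmt_13 (E ν δ : ℝ) (hE : 0 < E) (hν : 0 ≤ ν)
    (hδ : δ ∈ Set.Ioc 0 Real.pi)
    (c : ℝ) (hc : c = -|Real.cos δ|) (hcv : ¬(c = -1 ∧ ν = 0))
    (a σ : ℝ → ℝ)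
    (ha : ∀ r, a r = Real.sqrt (E - Real.sinh r ^ 2))
    (hσ : ∀ r, σ r = Real.sqrt (Real.exp (-(2 * r)) * (1 - c) / 2
      + Real.exp (2 * r) * (1 + c) / 2 + ν))
    (P : ℝ → ℝ)
    (hP : ∀ r, P r = minErr (gauss (-(a r * Real.sin (δ / 2))) (σ r))
      (gauss (a r * Real.sin (δ / 2)) (σ r)))
    (rstar : ℝ)
    (hr : rstar = (1/2) * Real.log
      ((Real.sqrt ((2 * E + 1 + ν) ^ 2 - 4 * E * (E + 1) * c ^ 2) + c)
        / ((c + 1) * (2 * E + 1) + ν))) :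
    rstar ∈ Set.Icc 0 (Real.arsinh (Real.sqrt E)) ∧
    (∀ r ∈ Set.Icc 0 (Real.arsinh (Real.sqrt E)), P rstar ≤ P r) ∧
    P rstar = (1/2) * (1 - erf (a rstar * Real.sin (δ / 2) / σ rstar)) := by
  have hc0 : c ≤ 0 := by rw [hc]; simp
  have hc1 : -1 ≤ c := by rw [hc]; linarith [Real.abs_cos_le_one δ]
  have hB : 0 < (2 * E + 1) * (1 + c) + ν := by
    rcases hν.lt_or_eq with h | h
    · have : 0 ≤ 1 + c := by linarith
      positivity
    · have : 0 < 1 + c := by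
        rcases hc1.lt_or_eq with h' | h'
        · linarith
        · exact absurd ⟨h'.symm, h.symm⟩ hcv
      positivity
  have hA : 0 < (2 * E + 1) * (1 - c) + ν := by
    have : 0 < 1 - c := by linarith
    positivity
  have hdisc : (2 * E + 1 + ν) ^ 2 - 4 * E * (E + 1) * c ^ 2
      = c ^ 2 + ((2 * E + 1) * (1 - c) + ν) * ((2 * E + 1) * (1 + c) + ν) := by ring
  have hAB := mul_pos hA hB
  set S := Real.sqrt ((2 * E + 1 + ν) ^ 2 - 4 * E * (E + 1) * c ^ 2) with hSdef
  have hS : 0 ≤ S := Real.sqrt_nonneg _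
  have hSsq : S ^ 2 = c ^ 2 + ((2 * E + 1) * (1 - c) + ν) * ((2 * E + 1) * (1 + c) + ν) := by
    rw [hSdef, Real.sq_sqrt (by rw [hdisc]; positivity), hdisc]
  have hcS : 0 < S + c := by
    have : -c < S := lt_of_pow_lt_pow_left₀ 2 hS (by rw [hSsq]; linarith [neg_sq c])
    linarith
  have hB' : (c + 1) * (2 * E + 1) + ν = (2 * E + 1) * (1 + c) + ν := by ring
  rw [hB'] at hr
  set y := (S + c) / ((2 * E + 1) * (1 + c) + ν) with hydef
  have hy : 0 < y := div_pos hcS hB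
  have hyS : ((2 * E + 1) * (1 + c) + ν) * y = c + S := by
    rw [hydef]; field_simp; ring
  have hroot : (2 * E + 1) * (1 - c) + ν + 2 * c * y
      - ((2 * E + 1) * (1 + c) + ν) * y ^ 2 = 0 := by
    refine (mul_eq_zero.1 ?_).resolve_left hB.ne'
    linear_combination -hSsq - (((2 * E + 1) * (1 + c) + ν) * y - c + S) * hyS
  have hexp : Real.exp (2 * rstar) = y := by
    rw [hr, ← mul_assoc]; norm_num [Real.exp_log hy]
  have hy1 : 1 ≤ y := isRoot_one_le hc0 (by linarith) hB hS hyS hroot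
  have hle : ∀ x : ℝ, 0 < x → snr (2 * E + 1) ν c x ≤ snr (2 * E + 1) ν c y := fun x hx =>
    snr_le_of_isRoot hν hc1 (by linarith) hx hy hS hyS hroot
  have hvar : ∀ r : ℝ, 0 < Real.exp (-(2 * r)) * (1 - c) / 2
      + Real.exp (2 * r) * (1 + c) / 2 + ν := by
    intro r
    have h₁ : 0 < 1 - c := by linarith
    have h₂ : 0 ≤ 1 + c := by linarith
    positivity
  have hsin : 0 ≤ Real.sin (δ / 2) :=
    Real.sin_nonneg_of_nonneg_of_le_pi (by linarith [hδ.1]) (by linarith [hδ.1, hδ.2])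
  have hPerf : ∀ r, P r = (1/2) * (1 - erf (a r * Real.sin (δ / 2) / σ r)) := by
    intro r
    rw [hP]
    refine minErr_gauss (mul_nonneg ?_ hsin) ?_
    · rw [ha]; exact Real.sqrt_nonneg _
    · rw [hσ]; exact Real.sqrt_pos.2 (hvar r)
  have hratio : ∀ r, a r * Real.sin (δ / 2) / σ r
      = Real.sqrt (snr (2 * E + 1) ν c (Real.exp (2 * r))) * Real.sin (δ / 2) := by
    intro r
    rw [mul_div_right_comm, ha, hσ, ← Real.sqrt_div' _ (hvar r).le, div_eq_snr]
  refine ⟨⟨?_, ?_⟩, fun r _ => ?_, hPerf rstar⟩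
  · rw [hr]
    exact mul_nonneg (by norm_num) (Real.log_nonneg hy1)
  · have hnn : 0 ≤ (E - Real.sinh rstar ^ 2) / (Real.exp (-(2 * rstar)) * (1 - c) / 2
        + Real.exp (2 * rstar) * (1 + c) / 2 + ν) := by
      rw [div_eq_snr, hexp]
      have h0 := div_eq_snr E ν c 0
      have hv0 := hvar 0
      simp only [Real.sinh_zero, mul_zero, Real.exp_zero] at h0 hv0
      refine le_trans ?_ (hle 1 one_pos)
      rw [← h0]
      exact div_nonneg (by simpa using hE.le) hv0.le
    have hsq : Real.sinh rstar ^ 2 ≤ E := by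
      have := (le_div_iff₀ (hvar rstar)).1 hnn
      linarith
    rw [← Real.sinh_le_sinh, Real.sinh_arsinh]
    exact Real.le_sqrt_of_sq_le hsq
  · rw [hPerf, hPerf, hratio, hratio, hexp]
    have hmono := erf_monotone (mul_le_mul_of_nonneg_right
      (Real.sqrt_le_sqrt (hle _ (Real.exp_pos (2 * r)))) hsin)
    linarith
end

section
/- Let E > 0, ν ≥ 0, and δ ∈ (0, π] with δ ≠ π/2, and let c := −|cos δ| (so c ∈ [−1, 0)), with ν > 0 in case c = −1. With a(r) := √(E − sinh²r), σ(r) := √(e^{−2r}(1−c)/2 + e^{2r}(1+c)/2 + ν), and r* := ½ ln[(√((2E+1+ν)² − 4E(E+1)c²) + c)/((c+1)(2E+1) + ν)], the optimal Gaussian reading error is strictly smaller than the Standard Quantum Limit: ½(1 − erf(a(r*) sin(δ/2)/σ(r*))) < ½(1 − erf(√E sin(δ/2)/√(1+ν))). -/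
theorem erf_strictMono : StrictMono erf := by
  intro a b hab
  have hcont : Continuous fun s : ℝ => Real.exp (-s ^ 2) := by fun_prop
  have hint : ∀ x y : ℝ,
      IntervalIntegrable (fun s : ℝ => Real.exp (-s ^ 2)) MeasureTheory.volume x y :=
    fun x y => hcont.intervalIntegrable x y
  have hpos : 0 < ∫ s in a..b, Real.exp (-s ^ 2) :=
    intervalIntegral.intervalIntegral_pos_of_pos (hint a b) (fun _ => Real.exp_pos _) hab
  have hadd := intervalIntegral.integral_add_adjacent_intervals (hint 0 a) (hint a b)
  unfold erf
  apply mul_lt_mul_of_pos_left _ (by positivity)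
  linarith

/-- With `N = 2E + 1` and `x = e^{2r}`, any root `x > 0` of the stationarity equation of the
signal-to-noise ratio gives a ratio strictly above the value at `x = 1`. -/
theorem signal_to_noise_lt_of_stationary {E ν c x : ℝ} (hE : 0 < E) (hν : 0 ≤ ν) (hc0 : c < 0)
    (hc1 : -1 ≤ c) (hx : 0 < x) (hD : 0 < (c + 1) * (2 * E + 1) + ν)
    (hroot : ((c + 1) * (2 * E + 1) + ν) * x ^ 2 - 2 * c * x
      - ((1 - c) * (2 * E + 1) + ν) = 0) :
    E / (1 + ν) < (E - (x + x⁻¹ - 2) / 4) / (x⁻¹ * (1 - c) / 2 + x * (1 + c) / 2 + ν) := by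
  have hcE : c * E < 0 := mul_neg_of_neg_of_pos hc0 hE
  have hx1 : 1 < x := by
    by_contra! h
    nlinarith [mul_nonneg hD.le (by nlinarith : 0 ≤ 1 - x ^ 2),
      mul_nonneg (neg_nonneg.2 hc0.le) (sub_nonneg.2 h)]
  have hgap : 0 < (x - 1) ^ 2 * (((c + 1) * (2 * E + 1) + ν) * x - c) :=
    mul_pos (pow_pos (by linarith) 2) (by nlinarith [mul_pos hD hx])
  have hxi : 0 < x⁻¹ := inv_pos.2 hx
  have hQ : 0 < x⁻¹ * (1 - c) / 2 + x * (1 + c) / 2 + ν := by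
    have := mul_pos hxi (by linarith : 0 < 1 - c)
    have := mul_nonneg hx.le (by linarith : 0 ≤ 1 + c)
    linarith
  rw [div_lt_div_iff₀ (by linarith) hQ, ← sub_pos]
  have key : (E - (x + x⁻¹ - 2) / 4) * (1 + ν)
      - E * (x⁻¹ * (1 - c) / 2 + x * (1 + c) / 2 + ν)
      = (x - 1) ^ 2 * (((c + 1) * (2 * E + 1) + ν) * x - c) / (4 * x) := by
    field_simp
    linear_combination (-2 * (x - 1)) * hroot
  rw [key]
  positivity

/-- for `δ ≠ π/2` the optimal Gaussian reading error is strictly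
smaller than the Standard Quantum Limit:
`½(1 − erf(a(r*) sin(δ/2)/σ(r*))) < ½(1 − erf(√E sin(δ/2)/√(1+ν)))`. -/
theorem stmt_14 (E ν δ : ℝ) (hE : 0 < E) (hν : 0 ≤ ν)
    (hδ : δ ∈ Set.Ioc 0 Real.pi) (hδ' : δ ≠ Real.pi / 2)
    (c : ℝ) (hc : c = -|Real.cos δ|) (hcv : c = -1 → 0 < ν)
    (rstar : ℝ)
    (hr : rstar = (1/2) * Real.log
      ((Real.sqrt ((2 * E + 1 + ν) ^ 2 - 4 * E * (E + 1) * c ^ 2) + c)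
        / ((c + 1) * (2 * E + 1) + ν))) :
    (1/2) * (1 - erf (Real.sqrt (E - Real.sinh rstar ^ 2) * Real.sin (δ / 2)
        / Real.sqrt (Real.exp (-(2 * rstar)) * (1 - c) / 2
          + Real.exp (2 * rstar) * (1 + c) / 2 + ν)))
      < (1/2) * (1 - erf (Real.sqrt E * Real.sin (δ / 2) / Real.sqrt (1 + ν))) := by
  obtain ⟨hδ0, hδπ⟩ := hδ
  have hπ := Real.pi_pos
  have hsin : 0 < Real.sin (δ / 2) := Real.sin_pos_of_pos_of_lt_pi (by linarith) (by linarith)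
  have hcos : Real.cos δ ≠ 0 := fun h => hδ' <|
    Real.injOn_cos ⟨hδ0.le, hδπ⟩ ⟨by linarith, by linarith⟩ (h.trans Real.cos_pi_div_two.symm)
  have hc0 : c < 0 := by rw [hc]; exact neg_lt_zero.2 (abs_pos.2 hcos)
  have hc1 : -1 ≤ c := by rw [hc]; exact neg_le_neg (Real.abs_cos_le_one δ)
  have hD : 0 < (c + 1) * (2 * E + 1) + ν := by
    rcases hc1.eq_or_lt with h | h
    · rw [← h]; linarith [hcv h.symm]
    · have := mul_pos (by linarith : 0 < c + 1) (by linarith : 0 < 2 * E + 1)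
      linarith
  have hG : 0 < (1 - c) * (2 * E + 1) + ν := by nlinarith
  have hdisc : (2 * E + 1 + ν) ^ 2 - 4 * E * (E + 1) * c ^ 2
      = c ^ 2 + ((c + 1) * (2 * E + 1) + ν) * ((1 - c) * (2 * E + 1) + ν) := by ring
  have hdisc0 : c ^ 2 < (2 * E + 1 + ν) ^ 2 - 4 * E * (E + 1) * c ^ 2 := by
    rw [hdisc]; linarith [mul_pos hD hG]
  set S := Real.sqrt ((2 * E + 1 + ν) ^ 2 - 4 * E * (E + 1) * c ^ 2) with hS
  have hS2 : S ^ 2 = (2 * E + 1 + ν) ^ 2 - 4 * E * (E + 1) * c ^ 2 :=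
    Real.sq_sqrt (by linarith [sq_nonneg c])
  have hSc : 0 < S + c := by
    have := Real.lt_sqrt_of_sq_lt (x := -c) (by rw [neg_sq]; exact hdisc0)
    linarith
  set x := (S + c) / ((c + 1) * (2 * E + 1) + ν) with hxdef
  have hx : 0 < x := div_pos hSc hD
  have hroot : ((c + 1) * (2 * E + 1) + ν) * x ^ 2 - 2 * c * x
      - ((1 - c) * (2 * E + 1) + ν) = 0 := by
    rw [hxdef]
    field_simp
    linear_combination hS2
  have hexp : Real.exp (2 * rstar) = x := by
    rw [hr, show 2 * (1 / 2 * Real.log x) = Real.log x by ring, Real.exp_log hx]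
  have hexp' : Real.exp (-(2 * rstar)) = x⁻¹ := by rw [Real.exp_neg, hexp]
  have hsinh : Real.sinh rstar ^ 2 = (x + x⁻¹ - 2) / 4 := by
    have h2 : Real.cosh (2 * rstar) = (x + x⁻¹) / 2 := by rw [Real.cosh_eq, hexp, hexp']
    rw [Real.cosh_two_mul, Real.cosh_sq] at h2
    linarith
  have hlt := signal_to_noise_lt_of_stationary hE hν hc0 hc1 hx hD hroot
  rw [hexp, hexp', hsinh]
  have hsqrt := Real.sqrt_lt_sqrt (by positivity) hlt
  have hQ : 0 ≤ x⁻¹ * (1 - c) / 2 + x * (1 + c) / 2 + ν := by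
    have := mul_pos (inv_pos.2 hx) (by linarith : 0 < 1 - c)
    have := mul_nonneg hx.le (by linarith : 0 ≤ 1 + c)
    linarith
  rw [Real.sqrt_div' _ (by linarith), Real.sqrt_div' _ hQ] at hsqrt
  have herf := erf_strictMono (mul_lt_mul_of_pos_right hsqrt hsin)
  rw [div_mul_eq_mul_div, div_mul_eq_mul_div] at herf
  linarith
end
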